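/- (Proposition 3.4(ii)) The smooth map Ψ : Ω → ℝ⁶ given by Ψ(x1, x2, x3, y1, y2, y3) = (x3, x2, x1, (x2^4/x1^4) y3, (x1^4/x3^4) y2, (x3^4/x2^4) y1) maps M̃⁴ into M̃⁴, and for every p ∈ M̃⁴ one has DΨ(p)[X1(p)] = X3(Ψ(p)), DΨ(p)[X2(p)] = X2(Ψ(p)), and DΨ(p)[X3(p)] = X1(Ψ(p)), where DΨ(p) denotes the Fréchet derivative of Ψ at p. -/

import Mathlib

noncomputable section

/-- `ℝ⁶` with its Euclidean inner product; coordinates `p 0, p 1, p 2` are `x₁, x₂, x₃`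
and `p 3, p 4, p 5` are `y₁, y₂, y₃`. -/
abbrev E6 := EuclideanSpace ℝ (Fin 6)

/-- The point of `ℝ⁶` with the given six coordinates. -/
noncomputable def mk6 (a b c d e f : ℝ) : E6 :=
  (EuclideanSpace.equiv (Fin 6) ℝ).symm ![a, b, c, d, e, f]

/-- The polynomial `F` of Proposition 3.2. -/
noncomputable def Fq (p : E6) : ℝ :=
  9 * (p 0) ^ 2 * (p 2) ^ 8 * ((p 1) ^ 2 + (p 2) ^ 2) * (p 3) ^ 2
    + 9 * (p 0) ^ 8 * (p 1) ^ 2 * ((p 0) ^ 2 - (p 2) ^ 2) * (p 4) ^ 2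
    - 9 * (p 1) ^ 8 * (p 2) ^ 2 * ((p 0) ^ 2 + (p 1) ^ 2) * (p 5) ^ 2
    - (p 0) ^ 2 * (p 1) ^ 2 * (p 2) ^ 2 *
      (2 * (p 0) ^ 2 * (p 1) ^ 4 - 2 * (p 0) ^ 2 * (p 2) ^ 4 - 2 * (p 1) ^ 2 * (p 2) ^ 4
        - (p 0) ^ 2 * (p 1) ^ 2 * (p 2) ^ 2)

/-- The polynomial `G` of Proposition 3.2. -/
noncomputable def Gq (p : E6) : ℝ := (p 1) ^ 2 - (p 0) ^ 2 - (p 2) ^ 2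

/-- The algebraic variety `M⁴`. -/
def M4 : Set E6 :=
  {p | Fq p = 0 ∧ Gq p = 0 ∧ 0 < p 0 ∧ 0 < p 1 ∧ 0 < p 2 ∧ ¬(p 3 = 0 ∧ p 4 = 0 ∧ p 5 = 0)}

/-- The half line `ℓ₊`: points of `M⁴` with `x = s(1, √2, 1)`, `s > 0`, `y = (0, 1, 0)`. -/
def ellP : Set E6 :=
  {p ∈ M4 | ∃ s : ℝ, 0 < s ∧ p 0 = s ∧ p 1 = s * Real.sqrt 2 ∧ p 2 = s ∧
    p 3 = 0 ∧ p 4 = 1 ∧ p 5 = 0}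

/-- The half line `ℓ₋`: points of `M⁴` with `x = s(1, √2, 1)`, `s > 0`, `y = (0, -1, 0)`. -/
def ellM : Set E6 :=
  {p ∈ M4 | ∃ s : ℝ, 0 < s ∧ p 0 = s ∧ p 1 = s * Real.sqrt 2 ∧ p 2 = s ∧
    p 3 = 0 ∧ p 4 = -1 ∧ p 5 = 0}

/-- The regular part `M̃⁴ = M⁴ \ (ℓ₋ ∪ ℓ₊)`. -/
def Mt4 : Set E6 := M4 \ (ellM ∪ ellP)

/-- `A₁` of Proposition 3.3. -/
noncomputable def A1 (p : E6) : ℝ :=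
  (1 / (p 1) ^ 4) * (3 * (p 1) ^ 4 - (p 2) ^ 4) * (p 3) ^ 2
    - ((p 0) ^ 6 / (p 2) ^ 8) * (3 * (p 0) ^ 2 - 2 * (p 2) ^ 2) * (p 4) ^ 2
    + ((p 1) ^ 4 / ((p 0) ^ 2 * (p 2) ^ 4)) * (3 * (p 0) ^ 2 + 2 * (p 1) ^ 2) * (p 5) ^ 2
    + (1 / (9 * (p 2) ^ 4)) * (5 * (p 0) ^ 4 + 2 * (p 1) ^ 2 * (p 2) ^ 2)

/-- `A₂` of Proposition 3.3. -/
noncomputable def A2 (p : E6) : ℝ :=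
  -((p 2) ^ 4 / ((p 0) ^ 4 * (p 1) ^ 2)) * (3 * (p 1) ^ 2 + 2 * (p 2) ^ 2) * (p 3) ^ 2
    - (1 / (p 2) ^ 4) * ((p 0) ^ 4 - 3 * (p 2) ^ 4) * (p 4) ^ 2
    - ((p 1) ^ 6 / (p 0) ^ 8) * (2 * (p 0) ^ 2 + 3 * (p 1) ^ 2) * (p 5) ^ 2
    - (1 / (9 * (p 0) ^ 4)) * (5 * (p 1) ^ 4 - 2 * (p 0) ^ 2 * (p 2) ^ 2)

/-- `A₃` of Proposition 3.3. -/
noncomputable def A3 (p : E6) : ℝ :=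
  ((p 2) ^ 6 / (p 1) ^ 8) * (2 * (p 1) ^ 2 + 3 * (p 2) ^ 2) * (p 3) ^ 2
    + ((p 0) ^ 4 / ((p 1) ^ 4 * (p 2) ^ 2)) * (2 * (p 0) ^ 2 - 3 * (p 2) ^ 2) * (p 4) ^ 2
    + (1 / (p 0) ^ 4) * (3 * (p 0) ^ 4 - (p 1) ^ 4) * (p 5) ^ 2
    + (1 / (9 * (p 1) ^ 4)) * (5 * (p 2) ^ 4 + 2 * (p 0) ^ 2 * (p 1) ^ 2)

/-- The vector field `X₁` of Proposition 3.3. -/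
noncomputable def X1 (p : E6) : E6 :=
  mk6 ((1 / (p 1) ^ 4) * (((p 1) ^ 4 + (p 1) ^ 2 * (p 2) ^ 2 + (p 2) ^ 4) * p 0 * p 3))
      ((1 / (p 1) ^ 4) * ((p 1) ^ 5 * p 3))
      ((1 / (p 1) ^ 4) * ((p 2) ^ 5 * p 3))
      ((1 / (p 1) ^ 4) * ((p 1) ^ 4 * A1 p))
      ((1 / (p 1) ^ 4) * (2 * (p 0) ^ 2 * (p 1) ^ 2 * p 3 * p 4))
      ((1 / (p 1) ^ 4) * ((8 * (p 2) ^ 2 + 2 * (p 0) ^ 2) * (p 2) ^ 2 * p 3 * p 5))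

/-- The vector field `X₂` of Proposition 3.3. -/
noncomputable def X2 (p : E6) : E6 :=
  mk6 ((1 / (p 2) ^ 4) * ((p 0) ^ 5 * p 4))
      ((1 / (p 2) ^ 4) * (((p 0) ^ 4 - (p 0) ^ 2 * (p 2) ^ 2 + (p 2) ^ 4) * p 1 * p 4))
      ((1 / (p 2) ^ 4) * ((p 2) ^ 5 * p 4))
      ((1 / (p 2) ^ 4) * ((8 * (p 0) ^ 2 - 2 * (p 1) ^ 2) * (p 0) ^ 2 * p 3 * p 4))
      ((1 / (p 2) ^ 4) * ((p 2) ^ 4 * A2 p))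
      ((1 / (p 2) ^ 4) * (2 * (p 1) ^ 2 * (p 2) ^ 2 * p 4 * p 5))

/-- The vector field `X₃` of Proposition 3.3. -/
noncomputable def X3 (p : E6) : E6 :=
  mk6 ((1 / (p 0) ^ 4) * ((p 0) ^ 5 * p 5))
      ((1 / (p 0) ^ 4) * ((p 1) ^ 5 * p 5))
      ((1 / (p 0) ^ 4) * (((p 0) ^ 4 + (p 0) ^ 2 * (p 1) ^ 2 + (p 1) ^ 4) * p 2 * p 5))
      ((1 / (p 0) ^ 4) * (-2 * (p 0) ^ 2 * (p 2) ^ 2 * p 3 * p 5))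
      ((1 / (p 0) ^ 4) * ((8 * (p 1) ^ 2 - 2 * (p 2) ^ 2) * (p 1) ^ 2 * p 4 * p 5))
      ((1 / (p 0) ^ 4) * ((p 0) ^ 4 * A3 p))

/-- The indexed family `X₁, X₂, X₃`. -/
noncomputable def Xv : Fin 3 → E6 → E6 := ![X1, X2, X3]

/-- The involution `Ψ(x₁,x₂,x₃,y₁,y₂,y₃) = (x₃,x₂,x₁,(x₂⁴/x₁⁴)y₃,(x₁⁴/x₃⁴)y₂,(x₃⁴/x₂⁴)y₁)`. -/
noncomputable def PsiMap (p : E6) : E6 :=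
  mk6 (p 2) (p 1) (p 0) (((p 1) ^ 4 / (p 0) ^ 4) * p 5) (((p 0) ^ 4 / (p 2) ^ 4) * p 4)
    (((p 2) ^ 4 / (p 1) ^ 4) * p 3)

@[simp] lemma mk6_apply (a b c d e f : ℝ) (i : Fin 6) : mk6 a b c d e f i = ![a, b, c, d, e, f] i :=
  rfl

/-- The directional derivative of `q ↦ (qᵢ⁴ / qⱼ⁴) qₖ` along `v`. -/
def ratioDeriv (i j k : Fin 6) (p v : E6) : ℝ :=
  (4 * p i ^ 3 * p j * v i - 4 * p i ^ 4 * v j) / p j ^ 5 * p k + p i ^ 4 / p j ^ 4 * v k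

lemma exists_hasFDerivAt_ratio (i j k : Fin 6) {p : E6} (hj : p j ≠ 0) :
    ∃ L : E6 →L[ℝ] ℝ, HasFDerivAt (fun q : E6 => q i ^ 4 / q j ^ 4 * q k) L p ∧
      ∀ v, L v = ratioDeriv i j k p v := by
  have hc (l : Fin 6) : HasFDerivAt (fun q : E6 => q l) (EuclideanSpace.proj l : E6 →L[ℝ] ℝ) p :=
    (EuclideanSpace.proj l : E6 →L[ℝ] ℝ).hasFDerivAt
  have hinv := (hasDerivAt_inv (pow_ne_zero 4 hj)).comp_hasFDerivAt p ((hc j).pow 4)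
  refine ⟨_, (((hc i).pow 4).mul hinv).mul (hc k), fun v => ?_⟩
  simp [ratioDeriv]
  field_simp
  ring

lemma fderiv_PsiMap_apply {p : E6} (h0 : p 0 ≠ 0) (h1 : p 1 ≠ 0) (h2 : p 2 ≠ 0) (v : E6) :
    fderiv ℝ PsiMap p v =
      mk6 (v 2) (v 1) (v 0) (ratioDeriv 1 0 5 p v) (ratioDeriv 0 2 4 p v)
        (ratioDeriv 2 1 3 p v) := by
  have hc (l : Fin 6) : ∃ L : E6 →L[ℝ] ℝ, HasFDerivAt (fun q : E6 => q l) L p ∧ ∀ v, L v = v l :=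
    ⟨_, (EuclideanSpace.proj l : E6 →L[ℝ] ℝ).hasFDerivAt, fun _ => rfl⟩
  have coord (i : Fin 6) : ∃ L : E6 →L[ℝ] ℝ, HasFDerivAt (fun q => PsiMap q i) L p ∧
      ∀ v, L v = mk6 (v 2) (v 1) (v 0) (ratioDeriv 1 0 5 p v) (ratioDeriv 0 2 4 p v)
        (ratioDeriv 2 1 3 p v) i := by
    fin_cases i
    exacts [hc 2, hc 1, hc 0, exists_hasFDerivAt_ratio 1 0 5 h0,
      exists_hasFDerivAt_ratio 0 2 4 h2, exists_hasFDerivAt_ratio 2 1 3 h1]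
  choose L hL hLv using coord
  have hdiff : DifferentiableAt ℝ PsiMap p :=
    (differentiableAt_euclidean (𝕜 := ℝ)).2 fun i => (hL i).differentiableAt
  ext i
  have h := ((EuclideanSpace.proj i : E6 →L[ℝ] ℝ).hasFDerivAt.comp p hdiff.hasFDerivAt).unique
    (hL i)
  rw [← hLv, ← h]
  rfl

lemma Fq_PsiMap {p : E6} (h0 : p 0 ≠ 0) (h1 : p 1 ≠ 0) (h2 : p 2 ≠ 0) (hG : Gq p = 0) :
    Fq (PsiMap p) = -Fq p := by
  simp [Fq, Gq, PsiMap] at hG ⊢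
  field_simp
  generalize p 0 = a at *
  generalize p 1 = b at *
  generalize p 2 = c at *
  have hb : b ^ 2 = a ^ 2 + c ^ 2 := by linarith
  grind

lemma PsiMap_mem_M4 {p : E6} (hp : p ∈ M4) : PsiMap p ∈ M4 := by
  obtain ⟨hF, hG, h0, h1, h2, hy⟩ := hp
  refine ⟨by rw [Fq_PsiMap h0.ne' h1.ne' h2.ne' hG, hF, neg_zero], ?_, h2, h1, h0, ?_⟩
  · simp [Gq, PsiMap] at hG ⊢
    linarith
  · simp [PsiMap, h0.ne', h1.ne', h2.ne']
    tauto

lemma mem_ell_of_PsiMap {p : E6} (hp : p ∈ M4) {ε : ℝ}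
    (h : ∃ s : ℝ, 0 < s ∧ PsiMap p 0 = s ∧ PsiMap p 1 = s * Real.sqrt 2 ∧ PsiMap p 2 = s ∧
      PsiMap p 3 = 0 ∧ PsiMap p 4 = ε ∧ PsiMap p 5 = 0) :
    ∃ s : ℝ, 0 < s ∧ p 0 = s ∧ p 1 = s * Real.sqrt 2 ∧ p 2 = s ∧
      p 3 = 0 ∧ p 4 = ε ∧ p 5 = 0 := by
  obtain ⟨-, -, h0, h1, h2, -⟩ := hp
  obtain ⟨s, hs, e0, e1, e2, e3, e4, e5⟩ := h
  simp [PsiMap, h0.ne', h1.ne', h2.ne'] at e0 e1 e2 e3 e4 e5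
  refine ⟨s, hs, e2, e1, e0, e5, ?_, e3⟩
  rwa [e0, e2, div_self (pow_ne_zero 4 hs.ne'), one_mul] at e4

lemma PsiMap_mem_Mt4 {p : E6} (hp : p ∈ Mt4) : PsiMap p ∈ Mt4 := by
  refine ⟨PsiMap_mem_M4 hp.1, fun h => hp.2 ?_⟩
  exact h.imp (fun h => ⟨hp.1, mem_ell_of_PsiMap hp.1 h.2⟩)
    (fun h => ⟨hp.1, mem_ell_of_PsiMap hp.1 h.2⟩)

lemma fderiv_PsiMap_X1 {p : E6} (h0 : p 0 ≠ 0) (h1 : p 1 ≠ 0) (h2 : p 2 ≠ 0) (hG : Gq p = 0) :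
    fderiv ℝ PsiMap p (X1 p) = X3 (PsiMap p) := by
  simp only [Gq] at hG
  rw [fderiv_PsiMap_apply h0 h1 h2]
  ext i
  fin_cases i <;> simp [ratioDeriv, X1, X3, A1, A3, PsiMap] <;> field_simp
  all_goals
    generalize p 0 = a at *
    generalize p 1 = b at *
    generalize p 2 = c at *
    have hb : b ^ 2 = a ^ 2 + c ^ 2 := by linarith
  all_goals first | ring1 | grind

lemma fderiv_PsiMap_X2 {p : E6} (h0 : p 0 ≠ 0) (h1 : p 1 ≠ 0) (h2 : p 2 ≠ 0) (hG : Gq p = 0) :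
    fderiv ℝ PsiMap p (X2 p) = X2 (PsiMap p) := by
  simp only [Gq] at hG
  rw [fderiv_PsiMap_apply h0 h1 h2]
  ext i
  fin_cases i <;> simp [ratioDeriv, X2, A2, PsiMap] <;> field_simp
  all_goals
    generalize p 0 = a at *
    generalize p 1 = b at *
    generalize p 2 = c at *
    have hb : b ^ 2 = a ^ 2 + c ^ 2 := by linarith
  all_goals first | ring1 | grind

lemma fderiv_PsiMap_X3 {p : E6} (h0 : p 0 ≠ 0) (h1 : p 1 ≠ 0) (h2 : p 2 ≠ 0) (hG : Gq p = 0) :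
    fderiv ℝ PsiMap p (X3 p) = X1 (PsiMap p) := by
  simp only [Gq] at hG
  rw [fderiv_PsiMap_apply h0 h1 h2]
  ext i
  fin_cases i <;> simp [ratioDeriv, X1, X3, A1, A3, PsiMap] <;> field_simp
  all_goals
    generalize p 0 = a at *
    generalize p 1 = b at *
    generalize p 2 = c at *
    have hb : b ^ 2 = a ^ 2 + c ^ 2 := by linarith
  all_goals first | ring1 | grind

/-- Proposition 3.4(ii): `Ψ` preserves `M̃⁴`, and its differential interchanges
`X₁` and `X₃` and preserves `X₂`. -/
theorem statement_19 :
    (∀ p ∈ Mt4, PsiMap p ∈ Mt4) ∧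
    (∀ p ∈ Mt4,
      fderiv ℝ PsiMap p (X1 p) = X3 (PsiMap p) ∧
      fderiv ℝ PsiMap p (X2 p) = X2 (PsiMap p) ∧
      fderiv ℝ PsiMap p (X3 p) = X1 (PsiMap p)) := by
  refine ⟨fun p hp => PsiMap_mem_Mt4 hp, fun p hp => ?_⟩
  obtain ⟨⟨-, hG, h0, h1, h2, -⟩, -⟩ := hp
  exact ⟨fderiv_PsiMap_X1 h0.ne' h1.ne' h2.ne' hG, fderiv_PsiMap_X2 h0.ne' h1.ne' h2.ne' hG,
    fderiv_PsiMap_X3 h0.ne' h1.ne' h2.ne' hG⟩
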